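/- arXiv:2205.00450 — 8 statements merged into one kernel-verified Lean document; each statement's English description precedes it below -/
import Mathlib

section
/- For every multi-issue bankruptcy problem with crossed claims (I, N, E, c, α) and every order σ on N, the allocation CSP^σ(I,N,E,c,α) is Pareto efficient: there is no feasible allocation a with a_j ≥ CSP^σ_j for all j ∈ N and a_j > CSP^σ_j for at least one j. -/
open Finset

/-- The constrained sequential priority allocation `CSP^σ` of a multi-issue bankruptcy
problem with crossed claims, defined recursively in increasing `σ`-order:
`CSP^σ_j = min (c j) (max 0 (min_{i ∈ α j} (e i - ∑_{k : i ∈ α k, σ k < σ j} CSP^σ_k)))`.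
The minimum over the (nonempty) finite set `α j` is expressed via `sInf`. -/
noncomputable def CSP {I N : Type*} [Fintype I] [Fintype N] [DecidableEq I] [DecidableEq N]
    (e : I → ℝ) (c : N → ℝ) (α : N → Finset I) (σ : N → ℕ) (j : N) : ℝ :=
  min (c j)
    (max 0 (sInf (↑((α j).image fun i =>
      e i - ∑ k ∈ (Finset.univ.filter fun k => i ∈ α k ∧ σ k < σ j).attach,
        CSP e c α σ k.1) : Set ℝ)))
termination_by σ j
decreasing_by
  have hk := k.2
  simp only [Finset.mem_filter, Finset.mem_univ, true_and] at hk
  exact hk.2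

/-- `(I, N, E, c, α)` is a multi-issue bankruptcy problem with crossed claims. -/
def IsMBC {I N : Type*} [Fintype I] [Fintype N] [DecidableEq I] [DecidableEq N]
    (e : I → ℝ) (c : N → ℝ) (α : N → Finset I) : Prop :=
  Nonempty I ∧ Nonempty N ∧ (∀ i, 0 ≤ e i) ∧ (∀ j, 0 ≤ c j) ∧ (∀ j, (α j).Nonempty) ∧
    ∀ i, e i < ∑ j ∈ Finset.univ.filter (fun j => i ∈ α j), c j

/-- `x` is a feasible allocation of the problem `(I, N, E, c, α)`. -/
def Feasible {I N : Type*} [Fintype I] [Fintype N] [DecidableEq I] [DecidableEq N]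
    (e : I → ℝ) (c : N → ℝ) (α : N → Finset I) (x : N → ℝ) : Prop :=
  (∀ j, 0 ≤ x j) ∧ (∀ j, x j ≤ c j) ∧
    ∀ i, ∑ j ∈ Finset.univ.filter (fun j => i ∈ α j), x j ≤ e i

/-- `x` is Pareto efficient: no feasible allocation weakly dominates it with a strict gain. -/
def ParetoEff {I N : Type*} [Fintype I] [Fintype N] [DecidableEq I] [DecidableEq N]
    (e : I → ℝ) (c : N → ℝ) (α : N → Finset I) (x : N → ℝ) : Prop :=
  ¬ ∃ a : N → ℝ, Feasible e c α a ∧ (∀ j, x j ≤ a j) ∧ ∃ j, x j < a j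

/-- The constrained random arrival rule: the average over all `|N|!` orders
(bijections `N ≃ Fin |N|`) of the constrained sequential priority allocations. -/
noncomputable def CRA {I N : Type*} [Fintype I] [Fintype N] [DecidableEq I] [DecidableEq N]
    (e : I → ℝ) (c : N → ℝ) (α : N → Finset I) (j : N) : ℝ :=
  (∑ σ : N ≃ Fin (Fintype.card N), CSP e c α (fun k => (σ k : ℕ)) j) /
    (Nat.factorial (Fintype.card N) : ℝ)

/-- For every MBC problem and every order `σ` on `N`, the allocation
`CSP^σ` is Pareto efficient. -/
theorem CSP_paretoEfficient {I N : Type*} [Fintype I] [Fintype N] [DecidableEq I] [DecidableEq N]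
    (e : I → ℝ) (c : N → ℝ) (α : N → Finset I) (hMBC : IsMBC e c α)
    (σ : N ≃ Fin (Fintype.card N)) :
    ParetoEff e c α (CSP e c α fun k => (σ k : ℕ)) := by
  rintro ⟨a, ⟨ha0, hac, hae⟩, hle, j, hj⟩
  obtain ⟨-, -, -, -, hα, -⟩ := hMBC
  have hlt : CSP e c α (fun k => (σ k : ℕ)) j < c j := lt_of_lt_of_le hj (hac j)
  rw [CSP] at hj hlt
  have hlt2 := (min_lt_iff.mp hlt).resolve_left (lt_irrefl _)
  rw [min_eq_right hlt2.le] at hj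
  have hs := lt_of_le_of_lt (le_max_right _ _) hj
  -- the minimum is attained at some issue `i`
  have hne := (hα j).image fun i =>
      e i - ∑ k ∈ (Finset.univ.filter fun k => i ∈ α k ∧ (σ k : ℕ) < (σ j : ℕ)).attach,
        CSP e c α (fun k => (σ k : ℕ)) k.1
  have hmem := Set.Nonempty.csInf_mem (Finset.coe_nonempty.mpr hne) (Finset.finite_toSet _)
  obtain ⟨i, hi, hie⟩ := Finset.mem_image.mp (Finset.mem_coe.mp hmem)
  rw [← hie, Finset.sum_attach _ (fun k => CSP e c α (fun k => (σ k : ℕ)) k)] at hs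
  have h1 : ∑ k ∈ Finset.univ.filter (fun k => i ∈ α k ∧ (σ k : ℕ) < (σ j : ℕ)),
      CSP e c α (fun k => (σ k : ℕ)) k ≤
      ∑ k ∈ Finset.univ.filter (fun k => i ∈ α k ∧ (σ k : ℕ) < (σ j : ℕ)), a k :=
    Finset.sum_le_sum fun k _ => hle k
  have hnot : j ∉ Finset.univ.filter (fun k => i ∈ α k ∧ (σ k : ℕ) < (σ j : ℕ)) := by simp
  have h2 : ∑ k ∈ insert j (Finset.univ.filter (fun k => i ∈ α k ∧ (σ k : ℕ) < (σ j : ℕ))), a k ≤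
      ∑ k ∈ Finset.univ.filter (fun k => i ∈ α k), a k := by
    refine Finset.sum_le_sum_of_subset_of_nonneg ?_ fun k _ _ => ha0 k
    intro k hk
    rcases Finset.mem_insert.mp hk with rfl | hk
    · simpa using hi
    · simp only [Finset.mem_filter, Finset.mem_univ, true_and] at hk ⊢
      exact hk.1
  rw [Finset.sum_insert hnot] at h2
  have h3 := hae i
  linarith
end

section
/- The constrained sequential priority rules are consistent: for every multi-issue bankruptcy problem with crossed claims (I, N, E, c, α), every order σ on N, and every nonempty subset N' ⊂ N, if one forms the reduced problem on N' with issue set I' = {i ∈ I : i ∈ α(k) for some k ∈ N'}, reduced endowments e'_i = e_i − ∑_{j ∈ N∖N' : i ∈ α(j)} CSP^σ_j(I,N,E,c,α) for i ∈ I', claims c restricted to N', α restricted to N', and the order on N' induced by σ, then CSP of the reduced problem gives every claimant j ∈ N' exactly CSP^σ_j(I,N,E,c,α). -/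
open Finset

section helpers
variable {I N : Type*} [Fintype I] [Fintype N] [DecidableEq I] [DecidableEq N]

theorem CSP_eq (e : I → ℝ) (c : N → ℝ) (α : N → Finset I) (σ : N → ℕ) (j : N) :
    CSP e c α σ j = min (c j)
    (max 0 (sInf (↑((α j).image fun i =>
      e i - ∑ k ∈ Finset.univ.filter (fun k => i ∈ α k ∧ σ k < σ j),
        CSP e c α σ k) : Set ℝ))) := by
  rw [CSP]
  congr 4
  refine Finset.image_congr fun i _ => ?_
  rw [Finset.sum_attach _ (fun k => CSP e c α σ k)]

theorem CSP_nonneg (e : I → ℝ) (c : N → ℝ) (α : N → Finset I) (σ : N → ℕ)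
    (hc : ∀ j, 0 ≤ c j) (j : N) : 0 ≤ CSP e c α σ j := by
  rw [CSP_eq]
  exact le_min (hc j) (le_max_left _ _)

theorem CSP_le_rem (e : I → ℝ) (c : N → ℝ) (α : N → Finset I) (σ : N → ℕ)
    (j : N) (i : I) (hi : i ∈ α j) : CSP e c α σ j ≤ max 0 (e i -
      ∑ k ∈ Finset.univ.filter (fun k => i ∈ α k ∧ σ k < σ j), CSP e c α σ k) := by
  rw [CSP_eq]
  refine (min_le_right _ _).trans (max_le_max le_rfl ?_)
  exact csInf_le (Finset.bddBelow _) (Finset.mem_coe.2 (Finset.mem_image_of_mem _ hi))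

theorem CSP_prefix (e : I → ℝ) (c : N → ℝ) (α : N → Finset I) (σ : N → ℕ)
    (hσ : Function.Injective σ) (he : ∀ i, 0 ≤ e i) (i : I) (n : ℕ) :
    ∑ k ∈ Finset.univ.filter (fun k => i ∈ α k ∧ σ k < n), CSP e c α σ k ≤ e i := by
  induction n with
  | zero => simpa using he i
  | succ n ih =>
    by_cases h : ∃ k, i ∈ α k ∧ σ k = n
    · obtain ⟨k, hk, rfl⟩ := h
      have : Finset.univ.filter (fun l => i ∈ α l ∧ σ l < σ k + 1)
          = insert k (Finset.univ.filter (fun l => i ∈ α l ∧ σ l < σ k)) := by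
        ext l
        simp only [Finset.mem_filter, Finset.mem_univ, true_and, Finset.mem_insert]
        constructor
        · rintro ⟨h1, h2⟩
          rcases Nat.lt_succ_iff_lt_or_eq.1 h2 with h | h
          · exact Or.inr ⟨h1, h⟩
          · exact Or.inl (hσ h)
        · rintro (rfl | ⟨h1, h2⟩)
          · exact ⟨hk, Nat.lt_succ_self _⟩
          · exact ⟨h1, by omega⟩
      rw [this, Finset.sum_insert (by simp)]
      have h2 := CSP_le_rem e c α σ k i hk
      rw [max_eq_right (by linarith)] at h2
      linarith
    · have : Finset.univ.filter (fun l => i ∈ α l ∧ σ l < n + 1)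
          = Finset.univ.filter (fun l => i ∈ α l ∧ σ l < n) := by
        ext l
        simp only [Finset.mem_filter, Finset.mem_univ, true_and]
        constructor
        · rintro ⟨h1, h2⟩
          refine ⟨h1, lt_of_le_of_ne (by omega) fun h3 => h ⟨l, h1, h3⟩⟩
        · rintro ⟨h1, h2⟩
          exact ⟨h1, by omega⟩
      rw [this]
      exact ih

theorem CSP_total (e : I → ℝ) (c : N → ℝ) (α : N → Finset I) (σ : N → ℕ)
    (hσ : Function.Injective σ) (he : ∀ i, 0 ≤ e i) (i : I) :
    ∑ k ∈ Finset.univ.filter (fun k => i ∈ α k), CSP e c α σ k ≤ e i := by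
  have h := CSP_prefix e c α σ hσ he i (Finset.univ.sup σ + 1)
  have h2 : Finset.univ.filter (fun k => i ∈ α k ∧ σ k < Finset.univ.sup σ + 1)
      = Finset.univ.filter (fun k => i ∈ α k) := by
    refine Finset.filter_congr fun k _ => ?_
    have : σ k ≤ Finset.univ.sup σ := Finset.le_sup (Finset.mem_univ k)
    exact ⟨fun h => h.1, fun h => ⟨h, by omega⟩⟩
  rwa [h2] at h

end helpers

/-- consistency of the constrained sequential priority rules.  For every MBC
problem, order `σ` on `N`, and nonempty proper subset `N'` of claimants, `CSP` of the reduced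
problem on `N'` (issues claimed by some member of `N'`, endowments diminished by what the
leaving claimants got, claims and `α` restricted, order induced by `σ`) gives every `j ∈ N'`
exactly what it got in the original problem. -/
theorem CSP_consistent {I N : Type*} [Fintype I] [Fintype N] [DecidableEq I] [DecidableEq N]
    (e : I → ℝ) (c : N → ℝ) (α : N → Finset I) (hMBC : IsMBC e c α)
    (σ : N ≃ Fin (Fintype.card N))
    (N' : Finset N) (hne : N'.Nonempty) (hproper : N' ⊂ Finset.univ)
    (σ' : {x // x ∈ N'} ≃ Fin (Fintype.card {x // x ∈ N'}))
    (hσ' : ∀ a b : {x // x ∈ N'}, σ' a < σ' b ↔ σ a.1 < σ b.1)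
    (j : {x // x ∈ N'}) :
    CSP (I := {i // i ∈ Finset.univ.filter fun i : I => ∃ k ∈ N', i ∈ α k})
      (fun i => e i.1 - ∑ h ∈ Finset.univ.filter (fun h => h ∉ N' ∧ i.1 ∈ α h),
        CSP e c α (fun x => (σ x : ℕ)) h)
      (fun k => c k.1)
      (fun k => (α k.1).subtype fun i => i ∈ Finset.univ.filter fun i : I => ∃ k ∈ N', i ∈ α k)
      (fun k => (σ' k : ℕ)) j
      = CSP e c α (fun x => (σ x : ℕ)) j.1 := by
  obtain ⟨-, -, he, hc, hα, -⟩ := hMBC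
  have hinj : Function.Injective (fun x => (σ x : ℕ)) :=
    fun a b h => σ.injective (Fin.ext h)
  induction hn : (σ' j : ℕ) using Nat.strong_induction_on generalizing j with
  | _ n ih =>
  subst hn
  rw [CSP_eq]
  set x : N → ℝ := CSP e c α (fun x => (σ x : ℕ)) with hx
  have hx0 : ∀ k, 0 ≤ x k := CSP_nonneg e c α _ hc
  -- the reduced remainders, once earlier claimants are known to be unchanged
  have hsum : ∀ i : {i // i ∈ Finset.univ.filter fun i : I => ∃ k ∈ N', i ∈ α k},
      ∑ k ∈ Finset.univ.filter (fun k : {x // x ∈ N'} =>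
        i ∈ ((α k.1).subtype fun i => i ∈ Finset.univ.filter fun i : I => ∃ k ∈ N', i ∈ α k)
          ∧ (σ' k : ℕ) < σ' j),
        CSP (I := {i // i ∈ Finset.univ.filter fun i : I => ∃ k ∈ N', i ∈ α k})
          (fun i => e i.1 - ∑ h ∈ Finset.univ.filter (fun h => h ∉ N' ∧ i.1 ∈ α h), x h)
          (fun k => c k.1)
          (fun k => (α k.1).subtype fun i =>
            i ∈ Finset.univ.filter fun i : I => ∃ k ∈ N', i ∈ α k)
          (fun k => (σ' k : ℕ)) k
      = ∑ k ∈ Finset.univ.filter (fun k : N => k ∈ N' ∧ i.1 ∈ α k ∧ σ k < σ j.1), x k := by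
    intro i
    refine Finset.sum_bij (fun k _ => k.1) ?_ ?_ ?_ ?_
    · intro k hk
      simp only [Finset.mem_filter, Finset.mem_univ, true_and, Finset.mem_subtype] at hk ⊢
      exact ⟨k.2, hk.1, (hσ' k j).1 hk.2⟩
    · intro a _ b _ h
      exact Subtype.ext h
    · intro k hk
      simp only [Finset.mem_filter, Finset.mem_univ, true_and] at hk
      refine ⟨⟨k, hk.1⟩, ?_, rfl⟩
      simp only [Finset.mem_filter, Finset.mem_univ, true_and, Finset.mem_subtype]
      exact ⟨hk.2.1, (hσ' ⟨k, hk.1⟩ j).2 hk.2.2⟩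
    · intro k hk
      simp only [Finset.mem_filter, Finset.mem_univ, true_and] at hk
      exact ih _ hk.2 k rfl
  simp only [hsum]
  obtain ⟨i₀, hi₀⟩ := hα j.1
  have hmem : ∀ i ∈ α j.1, i ∈ Finset.univ.filter fun i : I => ∃ k ∈ N', i ∈ α k := by
    intro i hi
    simp only [Finset.mem_filter, Finset.mem_univ, true_and]
    exact ⟨j.1, j.2, hi⟩
  apply le_antisymm
  · rw [hx, CSP_eq, ← hx]
    refine min_le_min le_rfl (max_le_max le_rfl ?_)
    refine le_csInf ⟨_, Finset.mem_coe.2 (Finset.mem_image_of_mem _ hi₀)⟩ ?_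
    intro b hb
    obtain ⟨i, hi, rfl⟩ := Finset.mem_image.1 (Finset.mem_coe.1 hb)
    refine (csInf_le (Finset.bddBelow _) (Finset.mem_coe.2 (Finset.mem_image_of_mem _
      (Finset.mem_subtype.2 (show ((⟨i, hmem i hi⟩ : {i // i ∈ Finset.univ.filter
        fun i : I => ∃ k ∈ N', i ∈ α k}) : I) ∈ α j.1 from hi))))).trans ?_
    have key : ∑ k ∈ Finset.univ.filter (fun k => i ∈ α k ∧ (σ k : ℕ) < σ j.1), x k
        ≤ ∑ h ∈ Finset.univ.filter (fun h => h ∉ N' ∧ i ∈ α h), x h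
          + ∑ k ∈ Finset.univ.filter (fun k : N => k ∈ N' ∧ i ∈ α k ∧ σ k < σ j.1), x k := by
      simp only [Finset.sum_filter]
      rw [← Finset.sum_add_distrib]
      refine Finset.sum_le_sum fun k _ => ?_
      have := hx0 k
      simp only [Fin.lt_def]
      split_ifs <;> first | linarith | (exfalso; tauto)
    simp only
    linarith
  · refine le_min ?_ (le_max_of_le_right ?_)
    · rw [hx, CSP_eq]
      exact min_le_left _ _
    · refine le_csInf ⟨_, Finset.mem_coe.2 (Finset.mem_image_of_mem _
        (Finset.mem_subtype.2 (show ((⟨i₀, hmem i₀ hi₀⟩ : {i // i ∈ Finset.univ.filter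
        fun i : I => ∃ k ∈ N', i ∈ α k}) : I) ∈ α j.1 from hi₀)))⟩ ?_
      intro b hb
      obtain ⟨i, hi, rfl⟩ := Finset.mem_image.1 (Finset.mem_coe.1 hb)
      have hi' : i.1 ∈ α j.1 := Finset.mem_subtype.1 hi
      have htot := CSP_total e c α (fun x => (σ x : ℕ)) hinj he i.1
      rw [← hx] at htot
      have key : x j.1 + (∑ h ∈ Finset.univ.filter (fun h => h ∉ N' ∧ i.1 ∈ α h), x h
          + ∑ k ∈ Finset.univ.filter (fun k : N => k ∈ N' ∧ i.1 ∈ α k ∧ σ k < σ j.1), x k)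
          ≤ ∑ k ∈ Finset.univ.filter (fun k => i.1 ∈ α k), x k := by
        have hj : x j.1 = ∑ k, if k = j.1 then x k else 0 := by simp
        rw [hj]
        simp only [Finset.sum_filter]
        rw [← Finset.sum_add_distrib, ← Finset.sum_add_distrib]
        refine Finset.sum_le_sum fun k _ => ?_
        have := hx0 k
        by_cases hkj : k = j.1
        · subst hkj
          simp [hi']
        · simp only [hkj, if_false]
          split_ifs <;> first | linarith | (exfalso; tauto)
      linarith
end

section
/- The constrained random arrival rule satisfies equal treatment of equals: for every multi-issue bankruptcy problem with crossed claims (I, N, E, c, α) and every pair of equal claimants j, k ∈ N (i.e. α(j) = α(k) and c_j = c_k), it holds that CRA_j(I,N,E,c,α) = CRA_k(I,N,E,c,α). -/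
open Finset

/-- Relabelling claimants by a permutation preserving claims and issue sets. -/
lemma CSP_comp_perm {I N : Type*} [Fintype I] [Fintype N] [DecidableEq I] [DecidableEq N]
    (e : I → ℝ) (c : N → ℝ) (α : N → Finset I) (τ : Equiv.Perm N)
    (hα : ∀ m, α (τ m) = α m) (hc : ∀ m, c (τ m) = c m) (σ : N → ℕ) :
    ∀ (n : ℕ) (m : N), σ (τ m) = n →
      CSP e c α (fun l => σ (τ l)) m = CSP e c α σ (τ m) := by
  intro n
  induction n using Nat.strong_induction_on with
  | _ n ih =>
    intro m hm
    have key : ∀ i, (∑ k ∈ (Finset.univ.filter fun k => i ∈ α k ∧ σ (τ k) < σ (τ m)).attach,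
          CSP e c α (fun l => σ (τ l)) k.1)
        = ∑ k ∈ (Finset.univ.filter fun k => i ∈ α k ∧ σ k < σ (τ m)).attach,
          CSP e c α σ k.1 := by
      intro i
      rw [Finset.sum_attach _ (fun k => CSP e c α (fun l => σ (τ l)) k),
        Finset.sum_attach _ (fun k => CSP e c α σ k)]
      refine Finset.sum_equiv τ ?_ ?_
      · intro k
        simp [hα]
      · intro k hk
        simp only [Finset.mem_filter, Finset.mem_univ, true_and] at hk
        exact ih _ (hm ▸ hk.2) k rfl
    rw [CSP, CSP, hα, hc]
    simp only [key]

/-- the constrained random arrival rule satisfies equal treatment of equals: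
equal claimants (`α j = α k` and `c j = c k`) receive the same amount. -/
theorem CRA_equalTreatmentOfEquals {I N : Type*}
    [Fintype I] [Fintype N] [DecidableEq I] [DecidableEq N]
    (e : I → ℝ) (c : N → ℝ) (α : N → Finset I) (hMBC : IsMBC e c α)
    (j k : N) (hhom : α j = α k) (hc : c j = c k) :
    CRA e c α j = CRA e c α k := by
  have hα : ∀ m, α (Equiv.swap j k m) = α m := by
    intro m
    rw [Equiv.swap_apply_def]
    split_ifs with h1 h2
    · rw [h1, hhom]
    · rw [h2, hhom]
    · rfl
  have hc' : ∀ m, c (Equiv.swap j k m) = c m := by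
    intro m
    rw [Equiv.swap_apply_def]
    split_ifs with h1 h2
    · rw [h1, hc]
    · rw [h2, hc]
    · rfl
  unfold CRA
  congr 1
  symm
  refine Fintype.sum_equiv (Equiv.equivCongr (Equiv.swap j k) (Equiv.refl _)) _ _ ?_
  intro σ
  have h := CSP_comp_perm e c α (Equiv.swap j k) hα hc' (fun l => (σ l : ℕ)) _ j rfl
  rw [Equiv.swap_apply_left] at h
  rw [← h]
  simp [Equiv.equivCongr]
end

section
/- Characterization of Pareto efficiency in MBC problems: a feasible allocation x of a multi-issue bankruptcy problem with crossed claims (I, N, E, c, α) is Pareto efficient if and only if for every claimant j ∈ N, either x_j = c_j or there exists an issue i ∈ α(j) with ∑_{k : i ∈ α(k)} x_k = e_i. -/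
open Finset

/-- characterization of Pareto efficiency in MBC problems.  A feasible
allocation `x` is Pareto efficient iff every claimant `j` either receives her full claim
or claims some issue whose endowment is exhausted. -/
theorem paretoEff_iff {I N : Type*} [Fintype I] [Fintype N] [DecidableEq I] [DecidableEq N]
    (e : I → ℝ) (c : N → ℝ) (α : N → Finset I) (hMBC : IsMBC e c α)
    (x : N → ℝ) (hx : Feasible e c α x) :
    ParetoEff e c α x ↔
      ∀ j : N, x j = c j ∨
        ∃ i ∈ α j, ∑ k ∈ Finset.univ.filter (fun k => i ∈ α k), x k = e i := by
  obtain ⟨-, -, -, -, hne, -⟩ := hMBC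
  obtain ⟨h0, hc, he⟩ := hx
  constructor
  · intro hP j
    by_contra hcon
    push Not at hcon
    obtain ⟨hj, hi⟩ := hcon
    have hjlt : x j < c j := lt_of_le_of_ne (hc j) hj
    obtain ⟨m, hm, hmin⟩ := Finset.exists_min_image (α j)
      (fun i => e i - ∑ k ∈ Finset.univ.filter (fun k => i ∈ α k), x k) (hne j)
    have hmlt := lt_of_le_of_ne (he m) (hi m hm)
    obtain ⟨δ, hδ, hδ1, hδ2⟩ : ∃ δ : ℝ, 0 < δ ∧ δ ≤ c j - x j ∧
        δ ≤ e m - ∑ k ∈ Finset.univ.filter (fun k => m ∈ α k), x k :=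
      ⟨min (c j - x j) (e m - ∑ k ∈ Finset.univ.filter (fun k => m ∈ α k), x k),
        lt_min (by linarith) (by linarith), min_le_left _ _, min_le_right _ _⟩
    apply hP
    refine ⟨fun k => x k + if k = j then δ else 0, ⟨?_, ?_, ?_⟩, ?_, j, ?_⟩
    · intro k
      have := h0 k
      dsimp only
      split_ifs <;> linarith
    · intro k
      have := hc k
      dsimp only
      split_ifs with h
      · subst h
        linarith
      · linarith
    · intro i
      rw [Finset.sum_add_distrib, Finset.sum_ite_eq']
      have := he i
      split_ifs with h
      · have h2 := hmin i (by simpa using h)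
        linarith
      · linarith
    · intro k
      dsimp only
      split_ifs <;> linarith
    · simpa using hδ
  · rintro h ⟨a, ⟨-, hac, hae⟩, hxa, j, hj⟩
    rcases h j with h | ⟨i, hi, hs⟩
    · have := hac j
      linarith
    · have h1 : ∑ k ∈ Finset.univ.filter (fun k => i ∈ α k), x k <
          ∑ k ∈ Finset.univ.filter (fun k => i ∈ α k), a k :=
        Finset.sum_lt_sum (fun k _ => hxa k) ⟨j, by simpa using hi, hj⟩
      have := hae i
      linarith
end

section
/- The constrained random arrival rule does not satisfy Pareto efficiency: there exists a multi-issue bankruptcy problem with crossed claims (I, N, E, c, α) such that the allocation CRA(I,N,E,c,α) is not Pareto efficient, i.e. there is a feasible allocation a with a_j ≥ CRA_j for all j ∈ N and a_j > CRA_j for some j. -/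
open Finset

lemma CSP_nonneg_aux {I N : Type*} [Fintype I] [Fintype N] [DecidableEq I] [DecidableEq N]
    (e : I → ℝ) (c : N → ℝ) (α : N → Finset I) (σ : N → ℕ) (j : N) (hc : 0 ≤ c j) :
    0 ≤ CSP e c α σ j := by
  rw [CSP]
  exact le_min hc (le_max_left _ _)

lemma CSP_first_aux (σ : Fin 3 → ℕ) (j : Fin 3) (hj : σ j = 0) :
    CSP (fun _ : Fin 3 => (1 : ℝ)) (fun _ : Fin 3 => 1) (fun j => Finset.univ.erase j) σ j = 1 := by
  rw [CSP]
  have hne : ((Finset.univ : Finset (Fin 3)).erase j).Nonempty := by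
    clear hj; revert j; decide
  have h : (1 : ℝ) ≤ sInf (↑(((Finset.univ : Finset (Fin 3)).erase j).image fun i =>
      (1 : ℝ) - ∑ k ∈ (Finset.univ.filter fun k : Fin 3 =>
          i ∈ (Finset.univ : Finset (Fin 3)).erase k ∧ σ k < σ j).attach,
        CSP (fun _ : Fin 3 => (1 : ℝ)) (fun _ : Fin 3 => 1)
          (fun j => Finset.univ.erase j) σ k.1) : Set ℝ) := by
    apply le_csInf
    · exact_mod_cast hne.image _
    · intro b hb
      rw [Finset.mem_coe, Finset.mem_image] at hb
      obtain ⟨i, _, rfl⟩ := hb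
      have : (Finset.univ.filter fun k : Fin 3 =>
          i ∈ (Finset.univ : Finset (Fin 3)).erase k ∧ σ k < σ j) = ∅ := by
        simp [hj]
      rw [Finset.sum_attach _ (fun k => CSP (fun _ : Fin 3 => (1 : ℝ)) (fun _ : Fin 3 => 1)
          (fun j => Finset.univ.erase j) σ k), this]
      simp
  exact min_eq_left (h.trans (le_max_right _ _))

lemma CSP_le_aux (σ : Fin 3 → ℕ) (j k : Fin 3) (hk : σ k = 0) (hj : σ j ≠ 0) :
    CSP (fun _ : Fin 3 => (1 : ℝ)) (fun _ : Fin 3 => 1) (fun j => Finset.univ.erase j) σ j ≤ 0 := by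
  have hk1 := CSP_first_aux σ k hk
  rw [CSP]
  refine (min_le_right _ _).trans (max_le le_rfl ?_)
  obtain ⟨i, hij, hik⟩ : ∃ i : Fin 3, i ≠ j ∧ i ≠ k := by
    clear hk hj hk1; revert j k; decide
  refine (csInf_le (Finset.bddBelow _) (Finset.mem_coe.2 (Finset.mem_image_of_mem _
    (Finset.mem_erase.2 ⟨hij, Finset.mem_univ i⟩)))).trans ?_
  rw [Finset.sum_attach _ (fun k => CSP (fun _ : Fin 3 => (1 : ℝ)) (fun _ : Fin 3 => 1)
          (fun j => Finset.univ.erase j) σ k), sub_nonpos]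
  refine hk1.ge.trans (Finset.single_le_sum
    (f := fun k => CSP (fun _ : Fin 3 => (1 : ℝ)) (fun _ : Fin 3 => 1)
          (fun j => Finset.univ.erase j) σ k)
    (fun l _ => CSP_nonneg_aux _ _ _ _ _ zero_le_one) ?_)
  simp only [Finset.mem_filter, Finset.mem_univ, Finset.mem_erase, true_and, and_true]
  exact ⟨hik, by omega⟩

lemma CRA_le_aux (j : Fin 3) :
    CRA (fun _ : Fin 3 => (1 : ℝ)) (fun _ : Fin 3 => 1) (fun j => Finset.univ.erase j) j
      ≤ 1 / 3 := by
  have h : ∀ σ : Fin 3 ≃ Fin (Fintype.card (Fin 3)),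
      CSP (fun _ : Fin 3 => (1 : ℝ)) (fun _ : Fin 3 => 1) (fun j => Finset.univ.erase j)
        (fun k => (σ k : ℕ)) j ≤ if (σ j : ℕ) = 0 then 1 else 0 := by
    intro σ
    split_ifs with hj
    · exact (CSP_first_aux _ j hj).le
    · exact CSP_le_aux _ j (σ.symm ⟨0, by simp⟩) (by simp) hj
  have hcard : (Finset.univ.filter fun σ : Fin 3 ≃ Fin (Fintype.card (Fin 3)) =>
      (σ j : ℕ) = 0).card = 2 := by
    clear h; revert j; decide
  have h2 := Finset.sum_le_sum fun σ (_ : σ ∈ Finset.univ) => h σ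
  rw [Finset.sum_boole, hcard] at h2
  rw [CRA, div_le_iff₀ (by positivity)]
  refine h2.trans ?_
  norm_num [Fintype.card_fin, Nat.factorial]

/-- the constrained random arrival rule does not satisfy Pareto efficiency:
there is an MBC problem whose `CRA` allocation is dominated by a feasible allocation. -/
theorem CRA_not_paretoEfficient :
    ∃ (nI nN : ℕ) (e : Fin nI → ℝ) (c : Fin nN → ℝ) (α : Fin nN → Finset (Fin nI)),
      IsMBC e c α ∧
      ∃ a : Fin nN → ℝ, Feasible e c α a ∧
        (∀ j, CRA e c α j ≤ a j) ∧ ∃ j, CRA e c α j < a j := by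
  have hf : ∀ i : Fin 3, (Finset.univ.filter fun j : Fin 3 =>
      i ∈ (Finset.univ : Finset (Fin 3)).erase j).card = 2 := by decide
  refine ⟨3, 3, fun _ => 1, fun _ => 1, fun j => Finset.univ.erase j,
    ⟨⟨0⟩, ⟨0⟩, fun _ => zero_le_one, fun _ => zero_le_one, by decide, ?_⟩,
    fun _ => 1 / 2, ⟨fun _ => by norm_num, fun _ => by norm_num, ?_⟩, ?_, 0, ?_⟩
  · intro i
    rw [Finset.sum_const, hf]; norm_num
  · intro i
    rw [Finset.sum_const, hf]; norm_num
  · intro j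
    exact (CRA_le_aux j).trans (by norm_num)
  · exact (CRA_le_aux 0).trans_lt (by norm_num)
end

section
/- For the multi-issue bankruptcy problem with crossed claims with issues I = {1,2}, claimants N = {1,2,3}, endowments E = (4,8), claims c = (2,5,7), and α(1) = {1}, α(2) = {1,2}, α(3) = {2}, the constrained random arrival allocation is CRA = (8/6, 13/6, 35/6), and this allocation is not Pareto efficient: increasing claimant 1's share to 11/6 while keeping the others fixed yields a feasible allocation dominating it. -/
open Finset

/-- The claims structure of the example. -/
abbrev exα : Fin 3 → Finset (Fin 2) := ![{0}, {0, 1}, {1}]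

lemma sInf_pair_real (a b : ℝ) : sInf ({a, b} : Set ℝ) = min a b := by
  exact csInf_pair a b

lemma csp_zero (σ : Fin 3 → ℕ) :
    CSP (![4, 8] : Fin 2 → ℝ) (![2, 5, 7] : Fin 3 → ℝ) exα σ 0
      = min 2 (max 0 (4 - if σ 1 < σ 0 then CSP (![4, 8] : Fin 2 → ℝ) ![2, 5, 7] exα σ 1 else 0)) := by
  rw [CSP]
  simp only [Finset.sum_attach _ (fun k => CSP (![4, 8] : Fin 2 → ℝ) ![2, 5, 7] exα σ k),
    Finset.sum_filter]
  simp [Fin.sum_univ_three]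

lemma csp_one (σ : Fin 3 → ℕ) :
    CSP (![4, 8] : Fin 2 → ℝ) (![2, 5, 7] : Fin 3 → ℝ) exα σ 1
      = min 5 (max 0 (min
        (4 - if σ 0 < σ 1 then CSP (![4, 8] : Fin 2 → ℝ) ![2, 5, 7] exα σ 0 else 0)
        (8 - if σ 2 < σ 1 then CSP (![4, 8] : Fin 2 → ℝ) ![2, 5, 7] exα σ 2 else 0))) := by
  rw [CSP]
  simp only [Finset.sum_attach _ (fun k => CSP (![4, 8] : Fin 2 → ℝ) ![2, 5, 7] exα σ k),
    Finset.sum_filter]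
  simp [Fin.sum_univ_three, Finset.image_insert, sInf_pair_real]

lemma csp_two (σ : Fin 3 → ℕ) :
    CSP (![4, 8] : Fin 2 → ℝ) (![2, 5, 7] : Fin 3 → ℝ) exα σ 2
      = min 7 (max 0 (8 - if σ 1 < σ 2 then CSP (![4, 8] : Fin 2 → ℝ) ![2, 5, 7] exα σ 1 else 0)) := by
  rw [CSP]
  simp only [Finset.sum_attach _ (fun k => CSP (![4, 8] : Fin 2 → ℝ) ![2, 5, 7] exα σ k),
    Finset.sum_filter]
  simp [Fin.sum_univ_three]

/-- Closed form of the sequential priority allocations of the example. -/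
def exVal (σ : Fin 3 → ℕ) : Fin 3 → ℕ :=
  ![if σ 1 < σ 0 ∧ σ 1 < σ 2 then 0 else 2,
    if σ 2 < σ 1 then 1 else if σ 0 < σ 1 then 2 else 4,
    if σ 2 < σ 1 then 7 else if σ 0 < σ 1 then 6 else 4]

lemma csp_val (σ : Fin 3 → ℕ) (h01 : σ 0 ≠ σ 1) (h12 : σ 1 ≠ σ 2) (j : Fin 3) :
    CSP (![4, 8] : Fin 2 → ℝ) (![2, 5, 7] : Fin 3 → ℝ) exα σ j = (exVal σ j : ℝ) := by
  have h0 := csp_zero σ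
  have h1 := csp_one σ
  have h2 := csp_two σ
  generalize CSP (![4, 8] : Fin 2 → ℝ) (![2, 5, 7] : Fin 3 → ℝ) exα σ = x at *
  rcases lt_or_gt_of_ne h01 with a | a <;> rcases lt_or_gt_of_ne h12 with b | b <;>
    simp only [a, b, a.not_gt, b.not_gt, if_true, if_false] at h0 h1 h2 <;>
    fin_cases j <;> simp [exVal, a, b, a.not_gt, b.not_gt] <;> norm_num at h0 h1 h2 <;>
    simp_all <;> norm_num

lemma cra_val : CRA (![4, 8] : Fin 2 → ℝ) (![2, 5, 7] : Fin 3 → ℝ)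
        (![{0}, {0, 1}, {1}] : Fin 3 → Finset (Fin 2)) = ![8 / 6, 13 / 6, 35 / 6] := by
  have hs : ∀ j, ∑ σ : Fin 3 ≃ Fin (Fintype.card (Fin 3)), exVal (fun k => (σ k : ℕ)) j
      = (![8, 13, 35] : Fin 3 → ℕ) j := by decide
  funext j
  have h : ∀ σ : Fin 3 ≃ Fin (Fintype.card (Fin 3)),
      CSP (![4, 8] : Fin 2 → ℝ) (![2, 5, 7] : Fin 3 → ℝ) exα (fun k => (σ k : ℕ)) j
        = (exVal (fun k => (σ k : ℕ)) j : ℝ) := by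
    intro σ
    apply csp_val
    · intro h
      have := σ.injective (Fin.ext h)
      exact absurd this (by decide)
    · intro h
      have := σ.injective (Fin.ext h)
      exact absurd this (by decide)
  unfold CRA
  rw [Finset.sum_congr rfl (fun σ _ => h σ), ← Nat.cast_sum, hs j]
  fin_cases j <;> simp [Nat.factorial] <;> norm_num

/-- for the MBC problem with `I = {1,2}`, `N = {1,2,3}`, `E = (4,8)`,
`c = (2,5,7)`, `α(1) = {1}`, `α(2) = {1,2}`, `α(3) = {2}`, the constrained random arrival
allocation is `CRA = (8/6, 13/6, 35/6)`, and it is not Pareto efficient: raising claimant 1's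
share to `11/6` while keeping the others fixed yields a feasible dominating allocation. -/
theorem CRA_example_not_pareto :
    IsMBC (![4, 8] : Fin 2 → ℝ) (![2, 5, 7] : Fin 3 → ℝ)
        (![{0}, {0, 1}, {1}] : Fin 3 → Finset (Fin 2)) ∧
    CRA (![4, 8] : Fin 2 → ℝ) (![2, 5, 7] : Fin 3 → ℝ)
        (![{0}, {0, 1}, {1}] : Fin 3 → Finset (Fin 2))
      = ![8 / 6, 13 / 6, 35 / 6] ∧
    Feasible (![4, 8] : Fin 2 → ℝ) (![2, 5, 7] : Fin 3 → ℝ)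
        (![{0}, {0, 1}, {1}] : Fin 3 → Finset (Fin 2))
        (![11 / 6, 13 / 6, 35 / 6] : Fin 3 → ℝ) ∧
    (∀ j, CRA (![4, 8] : Fin 2 → ℝ) (![2, 5, 7] : Fin 3 → ℝ)
        (![{0}, {0, 1}, {1}] : Fin 3 → Finset (Fin 2)) j
        ≤ (![11 / 6, 13 / 6, 35 / 6] : Fin 3 → ℝ) j) ∧
    CRA (![4, 8] : Fin 2 → ℝ) (![2, 5, 7] : Fin 3 → ℝ)
        (![{0}, {0, 1}, {1}] : Fin 3 → Finset (Fin 2)) 0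
      < (![11 / 6, 13 / 6, 35 / 6] : Fin 3 → ℝ) 0 := by
  rw [cra_val]
  refine ⟨⟨inferInstance, inferInstance, ?_, ?_, ?_, ?_⟩, rfl, ⟨?_, ?_, ?_⟩, ?_, ?_⟩
  · intro i; fin_cases i <;> simp
  · intro i; fin_cases i <;> simp
  · intro i; fin_cases i <;> simp
  · intro i; fin_cases i <;> simp [Finset.sum_filter, Fin.sum_univ_three] <;> norm_num
  · intro i; fin_cases i <;> simp <;> norm_num
  · intro i; fin_cases i <;> simp <;> norm_num
  · intro i; fin_cases i <;> simp [Finset.sum_filter, Fin.sum_univ_three] <;> norm_num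
  · intro i; fin_cases i <;> simp <;> norm_num
  · simp; norm_num
end

section
/- The constrained sequential priority rules do not satisfy resource monotonicity: there exist a multi-issue bankruptcy problem with crossed claims (I, N, E, c, α), an order σ on N, an endowment vector E' with e'_i ≥ e_i for every issue i, and a claimant j ∈ N such that CSP^σ_j(I,N,E',c,α) < CSP^σ_j(I,N,E,c,α). -/
open Finset

/-- the constrained sequential priority rules do not satisfy resource
monotonicity: there are an MBC problem, an order `σ`, a larger endowment vector `E'`,
and a claimant who receives strictly less under `E'` than under `E`. -/
theorem CSP_not_resourceMonotone :
    ∃ (nI nN : ℕ) (e : Fin nI → ℝ) (c : Fin nN → ℝ) (α : Fin nN → Finset (Fin nI))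
      (σ : Fin nN ≃ Fin (Fintype.card (Fin nN))) (e' : Fin nI → ℝ),
      IsMBC e c α ∧ (∀ i, e i ≤ e' i) ∧
      ∃ j, CSP e' c α (fun x => (σ x : ℕ)) j < CSP e c α (fun x => (σ x : ℕ)) j := by
  have hx : ∀ a : ℝ, 0 ≤ a → a ≤ 1 → ∀ e : Fin 2 → ℝ, e = ![a, 1] →
      CSP e ![1, 1] ![{0, 1}, {1}]
        (fun x : Fin 2 => ((finCongr (Fintype.card_fin 2).symm x : Fin _) : ℕ)) 1 = 1 - a := by
    rintro a h0 h1 e rfl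
    have hz : CSP ![a, 1] ![1, 1] ![{0, 1}, {1}]
        (fun x : Fin 2 => ((finCongr (Fintype.card_fin 2).symm x : Fin _) : ℕ)) 0 = a := by
      rw [CSP]
      have hs : ∀ i : Fin 2, (Finset.univ.filter fun k : Fin 2 =>
          i ∈ (![{0, 1}, {1}] : Fin 2 → Finset (Fin 2)) k ∧
          ((finCongr (Fintype.card_fin 2).symm k : Fin _) : ℕ) <
          ((finCongr (Fintype.card_fin 2).symm (0 : Fin 2) : Fin _) : ℕ)) = ∅ := by
        decide
      simp only [Finset.sum_attach _ (CSP _ _ _ _), hs]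
      simp [csInf_pair, h0, h1]
    rw [CSP]
    have hs : (Finset.univ.filter fun k : Fin 2 =>
        1 ∈ (![{0, 1}, {1}] : Fin 2 → Finset (Fin 2)) k ∧
        ((finCongr (Fintype.card_fin 2).symm k : Fin _) : ℕ) <
        ((finCongr (Fintype.card_fin 2).symm (1 : Fin 2) : Fin _) : ℕ)) = {0} := by
      decide
    have hα : (![{0, 1}, {1}] : Fin 2 → Finset (Fin 2)) 1 = {1} := rfl
    rw [hα, Finset.image_singleton, Finset.sum_attach _ (CSP _ _ _ _), hs,
      Finset.sum_singleton, hz]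
    simp [h0, h1]
  refine ⟨2, 2, ![0, 1], ![1, 1], ![{0, 1}, {1}], finCongr (Fintype.card_fin 2).symm,
    ![1 / 2, 1], ⟨inferInstance, inferInstance, ?_, ?_, ?_, ?_⟩, ?_, 1, ?_⟩
  · intro i; fin_cases i <;> simp
  · intro i; fin_cases i <;> simp
  · intro i; fin_cases i <;> simp
  · intro i; fin_cases i <;> simp [Finset.sum_filter, Fin.sum_univ_two]
  · intro i; fin_cases i <;> simp
  · rw [hx (1 / 2) (by norm_num) (by norm_num) _ rfl, hx 0 (by norm_num) (by norm_num) _ rfl]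
    norm_num
end

section
/- For the multi-issue bankruptcy problem with crossed claims with issues I = {1,2,3}, claimants N = {1,…,8}, claims c = (3,5,4,3,5,4,4,5), α(1)={1}, α(2)={1}, α(3)={1,2}, α(4)={1,2}, α(5)={2}, α(6)={2,3}, α(7)={2,3}, α(8)={3}, and the order σ given by the arrival sequence 1,3,5,7,2,4,6,8: with endowments E = (9,12,7) the constrained sequential priority allocation is CSP^σ = (3,2,4,0,5,0,3,4), while with the larger endowments E' = (9,13,7) it is CSP^σ = (3,2,4,0,5,0,4,3); in particular claimant 8 receives strictly less after the endowment of issue 2 increases. -/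
open Finset

theorem CSP_eq_of_fixed {I N : Type*} [Fintype I] [Fintype N] [DecidableEq I] [DecidableEq N]
    (e : I → ℝ) (c : N → ℝ) (α : N → Finset I) (σ : N → ℕ) (x : N → ℝ)
    (hx : ∀ j, min (c j) (max 0 (sInf (↑((α j).image fun i =>
      e i - ∑ k, if i ∈ α k ∧ σ k < σ j then x k else 0) : Set ℝ))) = x j) (j : N) :
    CSP e c α σ j = x j := by
  induction hn : σ j using Nat.strong_induction_on generalizing j with
  | _ n ih =>
    rw [CSP, ← hx j]
    have key : ∀ i, ∑ k ∈ (Finset.univ.filter fun k => i ∈ α k ∧ σ k < σ j).attach,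
        CSP e c α σ k.1 = ∑ k, if i ∈ α k ∧ σ k < σ j then x k else 0 := by
      intro i
      rw [Finset.sum_attach _ (fun k => CSP e c α σ k), ← Finset.sum_filter]
      refine Finset.sum_congr rfl fun k hk => ?_
      have hk2 := (Finset.mem_filter.1 hk).2.2
      exact ih (σ k) (hn ▸ hk2) k rfl
    simp only [key]

/-- for the MBC problem with `I = {1,2,3}`, `N = {1,…,8}`,
`c = (3,5,4,3,5,4,4,5)`, the given claim structure `α`, and the order with arrival
sequence `1,3,5,7,2,4,6,8` (so claimant `j` has position `![0,4,1,5,2,6,3,7] j`):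
with `E = (9,12,7)` the `CSP` allocation is `(3,2,4,0,5,0,3,4)`, while with the larger
`E' = (9,13,7)` it is `(3,2,4,0,5,0,4,3)`; in particular claimant 8 receives strictly
less after the endowment of issue 2 increases. -/
theorem CSP_not_resourceMonotone_example
    (σ : Fin 8 ≃ Fin (Fintype.card (Fin 8)))
    (hσ : ∀ j, (σ j : ℕ) = ![0, 4, 1, 5, 2, 6, 3, 7] j) :
    IsMBC (![9, 12, 7] : Fin 3 → ℝ) (![3, 5, 4, 3, 5, 4, 4, 5] : Fin 8 → ℝ)
        (![{0}, {0}, {0, 1}, {0, 1}, {1}, {1, 2}, {1, 2}, {2}] : Fin 8 → Finset (Fin 3)) ∧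
    (∀ j, CSP (![9, 12, 7] : Fin 3 → ℝ) (![3, 5, 4, 3, 5, 4, 4, 5] : Fin 8 → ℝ)
        (![{0}, {0}, {0, 1}, {0, 1}, {1}, {1, 2}, {1, 2}, {2}] : Fin 8 → Finset (Fin 3))
        (fun k => (σ k : ℕ)) j
      = (![3, 2, 4, 0, 5, 0, 3, 4] : Fin 8 → ℝ) j) ∧
    (∀ j, CSP (![9, 13, 7] : Fin 3 → ℝ) (![3, 5, 4, 3, 5, 4, 4, 5] : Fin 8 → ℝ)
        (![{0}, {0}, {0, 1}, {0, 1}, {1}, {1, 2}, {1, 2}, {2}] : Fin 8 → Finset (Fin 3))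
        (fun k => (σ k : ℕ)) j
      = (![3, 2, 4, 0, 5, 0, 4, 3] : Fin 8 → ℝ) j) ∧
    CSP (![9, 13, 7] : Fin 3 → ℝ) (![3, 5, 4, 3, 5, 4, 4, 5] : Fin 8 → ℝ)
        (![{0}, {0}, {0, 1}, {0, 1}, {1}, {1, 2}, {1, 2}, {2}] : Fin 8 → Finset (Fin 3))
        (fun k => (σ k : ℕ)) 7
      < CSP (![9, 12, 7] : Fin 3 → ℝ) (![3, 5, 4, 3, 5, 4, 4, 5] : Fin 8 → ℝ)
        (![{0}, {0}, {0, 1}, {0, 1}, {1}, {1, 2}, {1, 2}, {2}] : Fin 8 → Finset (Fin 3))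
        (fun k => (σ k : ℕ)) 7 := by
  have hs : (fun k => (σ k : ℕ)) = ![0, 4, 1, 5, 2, 6, 3, 7] := funext hσ
  rw [hs]
  have h1 := CSP_eq_of_fixed (![9, 12, 7] : Fin 3 → ℝ) (![3, 5, 4, 3, 5, 4, 4, 5] : Fin 8 → ℝ)
        (![{0}, {0}, {0, 1}, {0, 1}, {1}, {1, 2}, {1, 2}, {2}] : Fin 8 → Finset (Fin 3))
        ![0, 4, 1, 5, 2, 6, 3, 7] ![3, 2, 4, 0, 5, 0, 3, 4] (by
    intro j
    fin_cases j <;> simp [Fin.sum_univ_eight, csInf_pair] <;> norm_num)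
  have h2 := CSP_eq_of_fixed (![9, 13, 7] : Fin 3 → ℝ) (![3, 5, 4, 3, 5, 4, 4, 5] : Fin 8 → ℝ)
        (![{0}, {0}, {0, 1}, {0, 1}, {1}, {1, 2}, {1, 2}, {2}] : Fin 8 → Finset (Fin 3))
        ![0, 4, 1, 5, 2, 6, 3, 7] ![3, 2, 4, 0, 5, 0, 4, 3] (by
    intro j
    fin_cases j <;> simp [Fin.sum_univ_eight, csInf_pair] <;> norm_num)
  refine ⟨⟨inferInstance, inferInstance, ?_, ?_, ?_, ?_⟩, h1, h2, ?_⟩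
  · intro i; fin_cases i <;> simp
  · intro i; fin_cases i <;> simp
  · intro i; fin_cases i <;> simp
  · intro i
    rw [Finset.sum_filter]
    fin_cases i <;> simp [Fin.sum_univ_eight] <;> norm_num
  · rw [h1, h2]
    simp
    try norm_num
end
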